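/- Consider three agents and four items g_1, g_2, g_3, g_4 with additive valuations given by v_1(g_1,g_2,g_3,g_4) = (2,1,4,4), v_2(g_1,g_2,g_3,g_4) = (1,2,4,4), and v_3(g_1,g_2,g_3,g_4) = (4,4,2,1). There is no finite probability distribution over EF1 allocations of the four items to the three agents under which every item is allocated to every agent with probability exactly 1/3; that is, the equal-division fractional allocation is not EF1-realizable for this instance. -/

import Mathlib

open Finset

/-- `A` is an ordered partition of the item set `M` into `n` bundles. -/
def IsPartition {ι : Type*} [DecidableEq ι] {n : ℕ} (M : Finset ι)
    (A : Fin n → Finset ι) : Prop :=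
  (∀ i, A i ⊆ M) ∧ (∀ i j, i ≠ j → Disjoint (A i) (A j)) ∧ (∀ g ∈ M, ∃ i, g ∈ A i)

/-- The allocation `A` of the items `M` is EF^{+u}_{-w} for the additive valuations `v`. -/
def EFpm {ι : Type*} [DecidableEq ι] {n : ℕ} (M : Finset ι) (v : Fin n → ι → ℝ)
    (A : Fin n → Finset ι) (u w : ℕ) : Prop :=
  ∀ i j : Fin n, ∃ Si Sj : Finset ι,
    Si ⊆ M ∧ Disjoint Si (A i) ∧ Si.card ≤ u ∧
    Sj ⊆ A j ∧ Sj.card ≤ w ∧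
    ∑ g ∈ A j \ Sj, v i g ≤ ∑ g ∈ A i ∪ Si, v i g

/-- The concrete 3-agent, 4-item valuation profile from the paper. -/
def vCounter : Fin 3 → Fin 4 → ℝ :=
  ![![2, 1, 4, 4], ![1, 2, 4, 4], ![4, 4, 2, 1]]

/-- The natural-number version of the valuation profile. -/
def vNat : Fin 3 → Fin 4 → ℕ :=
  ![![2, 1, 4, 4], ![1, 2, 4, 4], ![4, 4, 2, 1]]

lemma vCounter_eq (i : Fin 3) (g : Fin 4) : vCounter i g = (vNat i g : ℝ) := by
  fin_cases i <;> fin_cases g <;> simp [vCounter, vNat]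

/-- The number of the four selected events that hold for an owner function. -/
def events (a b c d : Fin 3) : ℕ :=
  (if c = 2 then 1 else 0) + (if d = 2 then 1 else 0) + (if a = 1 then 1 else 0)
    + (if b = 0 then 1 else 0)

set_option maxRecDepth 100000 in
set_option maxHeartbeats 4000000 in
lemma finite_check : ∀ a b c d : Fin 3,
    (∀ i j : Fin 3, ∃ h : Fin 4,
      (∑ g : Fin 4, if ![a, b, c, d] g = j ∧ g ≠ h then vNat i g else 0) ≤
        ∑ g : Fin 4, if ![a, b, c, d] g = i then vNat i g else 0) →
    events a b c d ≤ 1 := by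
  simp only [Fin.sum_univ_four]
  decide +kernel

lemma alloc_check (A : Fin 3 → Finset (Fin 4)) (hP : IsPartition Finset.univ A)
    (hE : EFpm Finset.univ vCounter A 0 1) :
    (if (2 : Fin 4) ∈ A 2 then 1 else 0) + (if (3 : Fin 4) ∈ A 2 then 1 else 0)
      + (if (0 : Fin 4) ∈ A 1 then 1 else 0) + (if (1 : Fin 4) ∈ A 0 then 1 else 0) ≤ 1 := by
  obtain ⟨-, hd, hc⟩ := hP
  choose o ho using fun g => hc g (Finset.mem_univ g)
  have hmem : ∀ g i, g ∈ A i ↔ o g = i := by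
    intro g i
    constructor
    · intro h
      by_contra hne
      exact Finset.disjoint_left.mp (hd _ _ hne) (ho g) h
    · rintro rfl
      exact ho g
  have ho4 : ![o 0, o 1, o 2, o 3] = o := by
    ext g
    fin_cases g <;> rfl
  have key := finite_check (o 0) (o 1) (o 2) (o 3) (by
    intro i j
    rw [ho4]
    obtain ⟨Si, Sj, -, -, hSi, -, hSj, hle⟩ := hE i j
    have hSi0 : Si = ∅ := Finset.card_eq_zero.mp (by omega)
    subst hSi0
    obtain ⟨h, hh⟩ := Finset.card_le_one_iff_subset_singleton.mp hSj
    refine ⟨h, ?_⟩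
    rw [← Finset.sum_filter, ← Finset.sum_filter]
    have h1 : (Finset.univ.filter fun g => o g = j ∧ g ≠ h) ⊆ A j \ Sj := by
      intro g hg
      simp only [Finset.mem_filter, Finset.mem_univ, true_and] at hg
      refine Finset.mem_sdiff.mpr ⟨(hmem g j).mpr hg.1, fun hg2 => hg.2 ?_⟩
      simpa using hh hg2
    have h2 : (Finset.univ.filter fun g => o g = i) = A i := by
      ext g
      simp [hmem]
    rw [h2]
    refine (Finset.sum_le_sum_of_subset h1).trans ?_
    simp only [vCounter_eq, Finset.union_empty] at hle
    exact_mod_cast hle)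
  simpa only [events, hmem] using key

/-- For the instance `vCounter`, the equal-division fractional allocation (each item to each
agent with probability 1/3) is not EF1-realizable. -/
theorem equal_division_not_EF1_realizable_three_agents :
    ¬ ∃ (K : ℕ) (p : Fin K → ℝ) (A : Fin K → Fin 3 → Finset (Fin 4)),
      (∀ k, 0 ≤ p k) ∧ (∑ k, p k = 1) ∧
      (∀ k, IsPartition Finset.univ (A k)) ∧
      (∀ k, EFpm Finset.univ vCounter (A k) 0 1) ∧
      (∀ i g, ∑ k, (if g ∈ A k i then p k else 0) = 1 / 3) := by
  rintro ⟨K, p, A, hp, hs, hP, hE, hx⟩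
  have hk : ∀ k, (if (2 : Fin 4) ∈ A k 2 then p k else 0) + (if (3 : Fin 4) ∈ A k 2 then p k else 0)
      + (if (0 : Fin 4) ∈ A k 1 then p k else 0) + (if (1 : Fin 4) ∈ A k 0 then p k else 0)
      ≤ p k := by
    intro k
    have h := alloc_check (A k) (hP k) (hE k)
    have hpk := hp k
    split_ifs at h ⊢ <;> first | omega | linarith
  have hsum := Finset.sum_le_sum fun k (_ : k ∈ Finset.univ) => hk k
  rw [Finset.sum_add_distrib, Finset.sum_add_distrib, Finset.sum_add_distrib,
    hx, hx, hx, hx, hs] at hsum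
  norm_num at hsum
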